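/- arXiv:2307.13559 — 3 statements merged into one kernel-verified Lean document; each statement's English description precedes it below -/
import Mathlib

section
/- Let S be a commutative noetherian local ring with maximal ideal n and ω ∈ n a non-zerodivisor. Let f : P → Q and f' : P' → Q' be injective S-linear maps between finitely generated projective S-modules whose cokernels are annihilated by ω, with f_Σ : Q → P the unique map satisfying f ∘ f_Σ = ω·id_Q and f_Σ ∘ f = ω·id_P, and let (ψ₁,ψ₀) be a morphism from (P →f Q) to (P' →f' Q'). Define the mapping cone map c : P' × Q → Q' × P by c(p',q) = (f'(p') + ψ₀(q), −f_Σ(q)). Then c is injective and ω annihilates (Q' × P)/c(P' × Q), i.e., for every (x,y) ∈ Q' × P there exists (u,z) ∈ P' × Q with c(u,z) = (ω·x, ω·y). -/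
universe u

/-- the mapping cone `c(p', q) = (f'(p') + ψ₀(q), -f_Σ(q))` is injective
and its cokernel is annihilated by `ω`. -/
theorem stmt_4 {S : Type u} [CommRing S] [IsNoetherianRing S] [IsLocalRing S]
    (ω : S) (hω : ω ∈ IsLocalRing.maximalIdeal S) (hreg : ω ∈ nonZeroDivisors S)
    {P Q P' Q' : Type u} [AddCommGroup P] [Module S P] [AddCommGroup Q] [Module S Q]
    [AddCommGroup P'] [Module S P'] [AddCommGroup Q'] [Module S Q']
    [Module.Finite S P] [Module.Projective S P]
    [Module.Finite S Q] [Module.Projective S Q]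
    [Module.Finite S P'] [Module.Projective S P']
    [Module.Finite S Q'] [Module.Projective S Q']
    (f : P →ₗ[S] Q) (hinj : Function.Injective f)
    (hcok : ∀ q : Q, ω • q ∈ LinearMap.range f)
    (f' : P' →ₗ[S] Q') (hinj' : Function.Injective f')
    (hcok' : ∀ q : Q', ω • q ∈ LinearMap.range f')
    (fSig : Q →ₗ[S] P)
    (h1 : ∀ q : Q, f (fSig q) = ω • q) (h2 : ∀ p : P, fSig (f p) = ω • p)
    (ψ₁ : P →ₗ[S] P') (ψ₀ : Q →ₗ[S] Q')
    (hcomm : ∀ p : P, ψ₀ (f p) = f' (ψ₁ p))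
    (c : P' × Q →ₗ[S] Q' × P)
    (hc : ∀ (p' : P') (q : Q), c (p', q) = (f' p' + ψ₀ q, -fSig q)) :
    Function.Injective c ∧
      ∀ (x : Q') (y : P), ∃ (u : P') (z : Q), c (u, z) = (ω • x, ω • y) := by
  have hq0 : ∀ q : Q, ω • q = 0 → q = 0 := by
    intro q hq
    have hr : IsSMulRegular Q ω := Module.Flat.isSMulRegular_of_nonZeroDivisors hreg
    exact hr (by simpa using hq)
  constructor
  · rw [injective_iff_map_eq_zero]
    rintro ⟨p', q⟩ h
    rw [hc, Prod.mk_eq_zero, neg_eq_zero] at h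
    have hq : q = 0 := by
      apply hq0
      rw [← h1, h.2, map_zero]
    subst hq
    have hp : p' = 0 := by
      apply hinj'
      simpa using h.1
    rw [hp]
    rfl
  · intro x y
    obtain ⟨a, ha⟩ := hcok' x
    refine ⟨a + ψ₁ y, -f y, ?_⟩
    rw [hc, map_neg, map_neg, hcomm, h2, map_add, ha]
    simp
end

section
/- Let S be a commutative noetherian local ring with maximal ideal n, ω ∈ n a non-zerodivisor, and Q a finitely generated projective S-module. Let g : T₁ → T₀ be an injective S-linear map between finitely generated projective S-modules whose cokernel is annihilated by ω, and let φ₁ : T₁ → Q and φ₀ : T₀ → Q be surjective S-linear maps satisfying φ₀ ∘ g = ω·φ₁ (i.e., (φ₁,φ₀) is an epimorphism in Mon(ω,P) onto the object (Q →ω·id Q)). Then there exist S-linear maps ψ₁ : Q → T₁ and ψ₀ : Q → T₀ with g ∘ ψ₁ = ω·ψ₀, φ₁ ∘ ψ₁ = id_Q and φ₀ ∘ ψ₀ = id_Q; in other words, the object (Q →ω·id Q) is a projective object of Mon(ω,P). -/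
universe u

/-- `(Q →ω·id Q)` is a projective object of `Mon(ω, P)`: every
epimorphism onto it from an object `(T₁ →g T₀)` of `Mon(ω, P)` splits. -/
theorem stmt_6 {S : Type u} [CommRing S] [IsNoetherianRing S] [IsLocalRing S]
    (ω : S) (hω : ω ∈ IsLocalRing.maximalIdeal S) (hreg : ω ∈ nonZeroDivisors S)
    {Q T₁ T₀ : Type u} [AddCommGroup Q] [Module S Q]
    [AddCommGroup T₁] [Module S T₁] [AddCommGroup T₀] [Module S T₀]
    [Module.Finite S Q] [Module.Projective S Q]
    [Module.Finite S T₁] [Module.Projective S T₁]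
    [Module.Finite S T₀] [Module.Projective S T₀]
    (g : T₁ →ₗ[S] T₀) (hginj : Function.Injective g)
    (hgcok : ∀ t : T₀, ω • t ∈ LinearMap.range g)
    (φ₁ : T₁ →ₗ[S] Q) (φ₀ : T₀ →ₗ[S] Q)
    (hφ₁ : Function.Surjective φ₁) (hφ₀ : Function.Surjective φ₀)
    (hcomm : ∀ t : T₁, φ₀ (g t) = ω • φ₁ t) :
    ∃ (ψ₁ : Q →ₗ[S] T₁) (ψ₀ : Q →ₗ[S] T₀),
      (∀ q : Q, g (ψ₁ q) = ω • ψ₀ q) ∧ (∀ q : Q, φ₁ (ψ₁ q) = q) ∧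
        ∀ q : Q, φ₀ (ψ₀ q) = q := by
  obtain ⟨s, hs⟩ := Module.projective_lifting_property φ₀ LinearMap.id hφ₀
  have hs' : ∀ q, φ₀ (s q) = q := fun q => LinearMap.congr_fun hs q
  let r : Q →ₗ[S] LinearMap.range g :=
    LinearMap.codRestrict (LinearMap.range g) (ω • s) (fun q => hgcok (s q))
  let ψ : Q →ₗ[S] T₁ := (LinearEquiv.ofInjective g hginj).symm.toLinearMap ∘ₗ r
  have hψ : ∀ q, g (ψ q) = ω • s q := by
    intro q
    have h := congrArg Subtype.val ((LinearEquiv.ofInjective g hginj).apply_symm_apply (r q))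
    exact h
  refine ⟨ψ, s, hψ, ?_, hs'⟩
  intro q
  have h1 : ω • φ₁ (ψ q) = ω • q := by
    rw [← hcomm, hψ, map_smul, hs']
  obtain ⟨i, hi⟩ := (Module.projective_def' (R := S) (P := Q)).1 inferInstance
  have hinj : Function.Injective i := fun a b hab => by
    have h := congrArg (Finsupp.linearCombination S id) hab
    have e : ∀ x, Finsupp.linearCombination S id (i x) = x := fun x => LinearMap.congr_fun hi x
    rwa [e, e] at h
  apply hinj
  ext x
  have h2 := DFunLike.congr_fun (congrArg i h1) x
  simp only [map_smul, Finsupp.smul_apply, smul_eq_mul] at h2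
  exact (mul_cancel_left_mem_nonZeroDivisors hreg).1 h2
end

section
/- Let S be a commutative noetherian local ring with maximal ideal n, ω ∈ n a non-zerodivisor, and R = S/(ω). Let f : P → Q be an injective S-linear map between finitely generated projective S-modules whose cokernel M = Q/f(P) is annihilated by ω, and let f_Σ : Q → P be the unique map with f ∘ f_Σ = ω·id_Q and f_Σ ∘ f = ω·id_P. Then Ext^i_R(M, R) = 0 and Ext^i_R(P/f_Σ(Q), R) = 0 for all i ≥ 1, where M and P/f_Σ(Q) are regarded as R-modules. -/
universe u

open CategoryTheory

section helpers

open Limits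

lemma ext_isZero_of_endo {R : Type u} [CommRing R] {A M N : Type u}
    [AddCommGroup A] [Module R A] [AddCommGroup M] [Module R M] [AddCommGroup N] [Module R N]
    [Module.Projective R A] (d : A →ₗ[R] A) (p : A →ₗ[R] M)
    (hd : ∀ a, d (d a) = 0) (hex : ∀ a, d a = 0 → ∃ b, d b = a)
    (hpd : ∀ a, p (d a) = 0) (hp : ∀ a, p a = 0 → ∃ b, d b = a)
    (hsurj : Function.Surjective p)
    (hN : ∀ g : A →ₗ[R] N, (∀ a, g (d a) = 0) → ∃ h : A →ₗ[R] N, ∀ a, h (d a) = g a)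
    (i : ℕ) (hi : 1 ≤ i) :
    IsZero (((Ext R (ModuleCat.{u} R) i).obj
        (Opposite.op (ModuleCat.of R M))).obj (ModuleCat.of R N)) := by
  have hD : ModuleCat.ofHom d ≫ ModuleCat.ofHom d = 0 := by
    ext a; exact hd a
  let K : ChainComplex (ModuleCat.{u} R) ℕ :=
    ChainComplex.of (fun _ => ModuleCat.of R A) (fun _ => ModuleCat.ofHom d) (fun _ => hD)
  have hKd : ∀ n, K.d (n+1) n = ModuleCat.ofHom d := fun n =>
    ChainComplex.of_d (fun _ => ModuleCat.of R A) (fun _ => ModuleCat.ofHom d) n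
  let π : K ⟶ (ChainComplex.single₀ _).obj (ModuleCat.of R M) :=
    (K.toSingle₀Equiv _).symm ⟨ModuleCat.ofHom p, by
      rw [hKd]; ext a; exact hpd a⟩
  have hq : QuasiIso π := ⟨fun m => by
    cases m with
    | zero =>
      rw [ChainComplex.quasiIsoAt₀_iff, ShortComplex.quasiIso_iff_of_zeros' _ rfl rfl rfl]
      constructor
      · rw [ShortComplex.moduleCat_exact_iff]
        intro a ha
        obtain ⟨b, hb⟩ := hp a (by simpa [π, ChainComplex.toSingle₀Equiv] using! ha)
        exact ⟨b, (congrArg (fun φ => φ.hom b) (hKd 0)).trans hb⟩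
      · rw [ModuleCat.epi_iff_surjective]
        intro x
        obtain ⟨a, ha⟩ := hsurj x
        exact ⟨a, by simpa [π, ChainComplex.toSingle₀Equiv] using! ha⟩
    | succ m =>
      rw [quasiIsoAt_iff_exactAt' (hL := ChainComplex.exactAt_succ_single_obj ..),
          HomologicalComplex.exactAt_iff' _ (m + 2) (m + 1) m (by simp) (by simp)]
      rw [ShortComplex.moduleCat_exact_iff]
      intro a ha
      obtain ⟨b, hb⟩ := hex a (((congrArg (fun φ => φ.hom a) (hKd m)).symm.trans ha))
      exact ⟨b, (congrArg (fun φ => φ.hom b) (hKd (m+1))).trans hb⟩⟩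
  let res : ProjectiveResolution (ModuleCat.of R M) :=
    { complex := K
      projective := fun n => (IsProjective.iff_projective (R := R) A).1 inferInstance
      π := π
      quasiIso := hq }
  refine IsZero.of_iso ?_ (res.isoExt i (ModuleCat.of R N))
  rw [← HomologicalComplex.exactAt_iff_isZero_homology]
  obtain ⟨m, rfl⟩ : ∃ m, i = m + 1 := ⟨i - 1, by omega⟩
  rw [HomologicalComplex.exactAt_iff' _ m (m + 1) (m + 2) (by simp) (by simp)]
  rw [ShortComplex.moduleCat_exact_iff]
  intro (g : ModuleCat.of R A ⟶ ModuleCat.of R N) hg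
  have hg' : K.d (m+2) (m+1) ≫ g = 0 := hg
  rw [hKd (m+1)] at hg'
  obtain ⟨h, hh⟩ := hN g.hom (fun a => congrArg (fun φ => φ.hom a) hg')
  refine ⟨(ModuleCat.ofHom h : ModuleCat.of R A ⟶ ModuleCat.of R N), ?_⟩
  change K.d (m+1) m ≫ ModuleCat.ofHom h = g
  rw [hKd m]
  ext a
  exact hh a

lemma ext_isZero_of_retract {R : Type u} [CommRing R] {X X' Y : ModuleCat.{u} R} (i : ℕ)
    (s : X ⟶ X') (r : X' ⟶ X) (hsr : s ≫ r = 𝟙 X)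
    (h : IsZero (((Ext R (ModuleCat.{u} R) i).obj (Opposite.op X')).obj Y)) :
    IsZero (((Ext R (ModuleCat.{u} R) i).obj (Opposite.op X)).obj Y) := by
  let F := (Ext R (ModuleCat.{u} R) i).flip.obj Y
  have e : F.map r.op ≫ F.map s.op = 𝟙 _ := by
    rw [← F.map_comp, ← op_comp, hsr, op_id, F.map_id]
  rw [IsZero.iff_id_eq_zero]
  have h0 : F.map r.op = 0 := h.eq_of_tgt _ _
  change 𝟙 (F.obj (Opposite.op X)) = 0
  rw [← e, h0, zero_comp]

open TensorProduct

lemma one_tmul_eq_zero {S : Type u} [CommRing S] (ω : S) {A : Type u} [AddCommGroup A]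
    [Module S A] (a : A) (h : (1 : S ⧸ Ideal.span {ω}) ⊗ₜ[S] a = 0) : ∃ b : A, a = ω • b := by
  have h' := congrArg (TensorProduct.quotTensorEquivQuotSMul A (Ideal.span {ω})) h
  rw [map_zero] at h'
  have h2 := TensorProduct.quotTensorEquivQuotSMul_mk_tmul (M := A) (Ideal.span {ω}) 1 a
  rw [map_one] at h2
  rw [h2, one_smul, Submodule.Quotient.mk_eq_zero] at h'
  rw [Submodule.ideal_span_singleton_smul, Submodule.mem_smul_pointwise_iff_exists] at h'
  obtain ⟨b, -, hb⟩ := h'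
  exact ⟨b, hb.symm⟩

lemma exists_one_tmul {S : Type u} [CommRing S] (ω : S) {A : Type u} [AddCommGroup A]
    [Module S A] (x : (S ⧸ Ideal.span {ω}) ⊗[S] A) : ∃ a : A, x = 1 ⊗ₜ a := by
  induction x with
  | zero => exact ⟨0, by simp⟩
  | add x y hx hy =>
    obtain ⟨a, rfl⟩ := hx
    obtain ⟨b, rfl⟩ := hy
    exact ⟨a + b, by rw [TensorProduct.tmul_add]⟩
  | tmul r a =>
    obtain ⟨s, rfl⟩ := Ideal.Quotient.mk_surjective r
    refine ⟨s • a, ?_⟩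
    rw [← TensorProduct.smul_tmul]
    congr 1
    rw [← Ideal.Quotient.algebraMap_eq, Algebra.smul_def, mul_one]

lemma ext_isZero_of_sq {S : Type u} [CommRing S] (ω : S) (hreg : ω ∈ nonZeroDivisors S)
    {A M : Type u} [AddCommGroup A] [Module S A] [Module.Projective S A]
    [AddCommGroup M] [Module S M] [Module (S ⧸ Ideal.span {ω}) M]
    [IsScalarTower S (S ⧸ Ideal.span {ω}) M]
    (F : A →ₗ[S] A) (hF : ∀ a, F (F a) = ω • a) (p : A →ₗ[S] M)
    (hFi : Function.Injective F)
    (hpF : ∀ a, p (F a) = 0) (hp : ∀ a, p a = 0 → ∃ b, F b = a)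
    (hsurj : Function.Surjective p) (i : ℕ) (hi : 1 ≤ i) :
    IsZero (((Ext (S ⧸ Ideal.span {ω}) (ModuleCat.{u} (S ⧸ Ideal.span {ω})) i).obj
        (Opposite.op (ModuleCat.of (S ⧸ Ideal.span {ω}) M))).obj
      (ModuleCat.of (S ⧸ Ideal.span {ω}) (S ⧸ Ideal.span {ω}))) := by
  have hω0 : algebraMap S (S ⧸ Ideal.span {ω}) ω = 0 :=
    Ideal.Quotient.eq_zero_iff_mem.2 (Ideal.mem_span_singleton_self ω)
  have hωt : ∀ a : A, (1 : S ⧸ Ideal.span {ω}) ⊗ₜ[S] (ω • a) = 0 := fun a => by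
    rw [← TensorProduct.smul_tmul, Algebra.smul_def, hω0, zero_mul, TensorProduct.zero_tmul]
  refine ext_isZero_of_endo (A := (S ⧸ Ideal.span {ω}) ⊗[S] A)
    (F.baseChange (S ⧸ Ideal.span {ω})) (p.liftBaseChange (S ⧸ Ideal.span {ω}))
    ?_ ?_ ?_ ?_ ?_ ?_ i hi
  · intro x
    obtain ⟨a, rfl⟩ := exists_one_tmul ω x
    simp only [LinearMap.baseChange_tmul, hF, hωt]
  · intro x hx
    obtain ⟨a, rfl⟩ := exists_one_tmul ω x
    rw [LinearMap.baseChange_tmul] at hx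
    obtain ⟨b, hb⟩ := one_tmul_eq_zero ω _ hx
    exact ⟨1 ⊗ₜ b, by rw [LinearMap.baseChange_tmul, hFi (hb.trans (hF b).symm)]⟩
  · intro x
    obtain ⟨a, rfl⟩ := exists_one_tmul ω x
    simp [hpF]
  · intro x hx
    obtain ⟨a, rfl⟩ := exists_one_tmul ω x
    obtain ⟨b, hb⟩ := hp a (by simpa using hx)
    exact ⟨1 ⊗ₜ b, by rw [LinearMap.baseChange_tmul, hb]⟩
  · intro m
    obtain ⟨a, ha⟩ := hsurj m
    exact ⟨1 ⊗ₜ a, by simp [ha]⟩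
  · intro g hg
    let q : S →ₗ[S] (S ⧸ Ideal.span {ω}) := Algebra.linearMap S _
    have hq : Function.Surjective q := Ideal.Quotient.mk_surjective
    let g' : A →ₗ[S] (S ⧸ Ideal.span {ω}) :=
      (g.restrictScalars S).comp (TensorProduct.mk S (S ⧸ Ideal.span {ω}) A 1)
    have hg' : ∀ a, g' a = g (1 ⊗ₜ a) := fun a => rfl
    obtain ⟨G, hG⟩ := Module.projective_lifting_property q g' hq
    have hG' : ∀ a, q (G a) = g (1 ⊗ₜ a) := fun a => congrArg (fun φ => φ a) hG
    have hdiv : ∀ a, ∃ s, G (F a) = ω * s := fun a => by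
      have h0 : q (G (F a)) = 0 := by
        rw [hG', ← LinearMap.baseChange_tmul]; exact hg _
      exact Ideal.mem_span_singleton.1 (Ideal.Quotient.eq_zero_iff_mem.1 h0)
    choose H hH using hdiv
    have hc : ∀ {x y : S}, ω * x = ω * y → x = y := fun h =>
      (mul_cancel_left_mem_nonZeroDivisors hreg).1 h
    let H' : A →ₗ[S] S :=
      { toFun := H
        map_add' := fun a b => hc (by rw [← hH, mul_add, ← hH, ← hH, map_add, map_add])
        map_smul' := fun s a => hc (by
          rw [← hH, map_smul, map_smul, hH]; simp only [smul_eq_mul, RingHom.id_apply]; ring) }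
    refine ⟨(q.comp H').liftBaseChange (S ⧸ Ideal.span {ω}), fun x => ?_⟩
    obtain ⟨a, rfl⟩ := exists_one_tmul ω x
    rw [LinearMap.baseChange_tmul, LinearMap.liftBaseChange_tmul, one_smul, ← hG']
    change q (H (F a)) = _
    congr 1
    apply hc
    rw [← hH, hF, map_smul, smul_eq_mul]

end helpers

/-- for `R = S/(ω)`, the `R`-modules `Coker f = Q/f(P)` and
`Coker f_Σ = P/f_Σ(Q)` satisfy `Ext^i_R(-, R) = 0` for all `i ≥ 1`.  The natural
`R`-module structures on the cokernels are pinned down by the scalar-tower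
hypotheses. -/
theorem stmt_10 {S : Type u} [CommRing S] [IsNoetherianRing S] [IsLocalRing S]
    (ω : S) (hω : ω ∈ IsLocalRing.maximalIdeal S) (hreg : ω ∈ nonZeroDivisors S)
    {P Q : Type u} [AddCommGroup P] [Module S P] [AddCommGroup Q] [Module S Q]
    [Module.Finite S P] [Module.Projective S P]
    [Module.Finite S Q] [Module.Projective S Q]
    (f : P →ₗ[S] Q) (hinj : Function.Injective f)
    (hcok : ∀ q : Q, ω • q ∈ LinearMap.range f)
    (fSig : Q →ₗ[S] P)
    (h1 : ∀ q : Q, f (fSig q) = ω • q) (h2 : ∀ p : P, fSig (f p) = ω • p)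
    [Module (S ⧸ Ideal.span {ω}) (Q ⧸ LinearMap.range f)]
    [IsScalarTower S (S ⧸ Ideal.span {ω}) (Q ⧸ LinearMap.range f)]
    [Module (S ⧸ Ideal.span {ω}) (P ⧸ LinearMap.range fSig)]
    [IsScalarTower S (S ⧸ Ideal.span {ω}) (P ⧸ LinearMap.range fSig)]
    (i : ℕ) (hi : 1 ≤ i) :
    Subsingleton (((Ext (S ⧸ Ideal.span {ω}) (ModuleCat.{u} (S ⧸ Ideal.span {ω})) i).obj
        (Opposite.op (ModuleCat.of (S ⧸ Ideal.span {ω}) (Q ⧸ LinearMap.range f)))).obj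
      (ModuleCat.of (S ⧸ Ideal.span {ω}) (S ⧸ Ideal.span {ω}))) ∧
    Subsingleton (((Ext (S ⧸ Ideal.span {ω}) (ModuleCat.{u} (S ⧸ Ideal.span {ω})) i).obj
        (Opposite.op (ModuleCat.of (S ⧸ Ideal.span {ω}) (P ⧸ LinearMap.range fSig)))).obj
      (ModuleCat.of (S ⧸ Ideal.span {ω}) (S ⧸ Ideal.span {ω}))) := by
  let A := Q × P
  let F : (Q × P) →ₗ[S] (Q × P) :=
    (f.comp (LinearMap.snd S Q P)).prod (fSig.comp (LinearMap.fst S Q P))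
  let p : (Q × P) →ₗ[S] ((Q ⧸ LinearMap.range f) × (P ⧸ LinearMap.range fSig)) :=
    (LinearMap.range f).mkQ.prodMap (LinearMap.range fSig).mkQ
  have hcanc : ∀ q : Q, ω • q = 0 → q = 0 := fun q hq => by
    obtain ⟨s, hs⟩ := Module.projective_def.1 (inferInstance : Module.Projective S Q)
    have h0 : ω • s q = 0 := by rw [← map_smul, hq, map_zero]
    have h3 : s q = 0 := by
      ext a
      have h4 : ω * (s q) a = 0 := by
        simpa using congrArg (fun φ => φ a) h0
      exact (mul_left_mem_nonZeroDivisors_eq_zero_iff hreg).1 h4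
    rw [← hs q, h3, map_zero]
  have hFi : Function.Injective F := by
    rw [injective_iff_map_eq_zero]
    rintro ⟨q, x⟩ h
    have ha : f x = 0 := congrArg Prod.fst h
    have hb : fSig q = 0 := congrArg Prod.snd h
    have hx : x = 0 := hinj (by rw [ha, map_zero])
    have hq : q = 0 := hcanc q (by rw [← h1, hb, map_zero])
    rw [hx, hq]; rfl
  have key := ext_isZero_of_sq ω hreg F
    (fun a => Prod.ext (h1 a.1) (h2 a.2)) p hFi
    (fun a => Prod.ext
      ((Submodule.Quotient.mk_eq_zero _).2 ⟨a.2, rfl⟩)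
      ((Submodule.Quotient.mk_eq_zero _).2 ⟨a.1, rfl⟩))
    (fun a ha => by
      obtain ⟨x, hx⟩ := (Submodule.Quotient.mk_eq_zero _).1 (congrArg Prod.fst ha)
      obtain ⟨q, hq⟩ := (Submodule.Quotient.mk_eq_zero _).1 (congrArg Prod.snd ha)
      exact ⟨(q, x), Prod.ext hx hq⟩)
    (Function.Surjective.prodMap (Submodule.mkQ_surjective _) (Submodule.mkQ_surjective _)) i hi
  constructor
  · exact ModuleCat.subsingleton_of_isZero (ext_isZero_of_retract i
      (ModuleCat.ofHom (LinearMap.inl _ _ _)) (ModuleCat.ofHom (LinearMap.fst _ _ _)) rfl key)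
  · exact ModuleCat.subsingleton_of_isZero (ext_isZero_of_retract i
      (ModuleCat.ofHom (LinearMap.inr _ _ _)) (ModuleCat.ofHom (LinearMap.snd _ _ _)) rfl key)
end
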